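/- Let 𝒮 = {T_1,…,T_m} be a finite collection of piecewise C² uniformly expanding maps of [0,1] (for each T ∈ 𝒮 a finite interval partition 𝒜_T on whose pieces T extends to a strictly monotone C² map of the closure, with min_T min_I inf |T'| = λ > 1). For ω ∈ Ω := {1,…,m}^ℤ with left shift σ, write T_ω^n := T_{ω_{n−1}} ∘ ⋯ ∘ T_{ω_0}, let m be Lebesgue measure on [0,1], and for measurable U ⊆ [0,1] let R_U(ω)(x) := inf{ k ≥ 1 : T_ω^k(x) ∈ U }. Let a > 0, 2/3 < ψ < 1 and 0 < κ < 3ψ − 2. Then there exist sequences (γ_1(n)) and (γ_2(n)) with γ_1(n) = O(n^{−κ}) and γ_2(n) → 0, and for every ω ∈ Ω measurable sets A_n^ω ⊆ [0,1] with m(A_n^ω) ≤ γ_1(n), such that for every n and every x0 ∉ A_n^ω: (log n) · Σ_{i=0}^{n−1} m( B_{n^{−ψ}}(x0) ∩ { x : R_{B_{n^{−ψ}}(x0)}(σ^i ω)(x) ≤ ⌊a log n⌋ } ) ≤ γ_2(n), where B_r(x0) := { x ∈ [0,1] : |x − x0| < r }. -/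

import Mathlib

open MeasureTheory Filter Set Topology

noncomputable section

/-- The two-sided shift space on `m` symbols. -/
abbrev Om (m : ℕ) := ℤ → Fin m

/-- The left shift on the two-sided shift space. -/
def shift {m : ℕ} (ω : Om m) : Om m := fun i => ω (i + 1)

/-- Lebesgue measure on `[0,1]`. -/
def mLeb : Measure ℝ := volume.restrict (Set.Icc 0 1)

/-- `T` is a piecewise `C²` uniformly expanding map of `[0,1]` with expansion constant `lam`. -/
def PiecewiseC2Expanding (T : ℝ → ℝ) (lam : ℝ) : Prop :=
  ∃ (N : ℕ) (a : ℕ → ℝ), 1 ≤ N ∧ a 0 = 0 ∧ a N = 1 ∧ (∀ i < N, a i < a (i + 1)) ∧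
    ∀ i < N, ∃ g : ℝ → ℝ,
      ContDiffOn ℝ 2 g (Set.Icc (a i) (a (i + 1))) ∧
      Set.EqOn T g (Set.Ioo (a i) (a (i + 1))) ∧
      (StrictMonoOn g (Set.Icc (a i) (a (i + 1))) ∨
        StrictAntiOn g (Set.Icc (a i) (a (i + 1)))) ∧
      ∀ x ∈ Set.Icc (a i) (a (i + 1)),
        lam ≤ |derivWithin g (Set.Icc (a i) (a (i + 1))) x|

/-- The random composition `T_ω^n = T_{ω_{n−1}} ∘ ⋯ ∘ T_{ω_0}`. -/
def randComp {m : ℕ} (T : Fin m → ℝ → ℝ) (ω : Om m) : ℕ → ℝ → ℝ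
  | 0 => fun x => x
  | n + 1 => fun x => T (ω (n : ℤ)) (randComp T ω n x)

/-- The event `{x : R_U(ω)(x) ≤ N}` that the random orbit hits `U` within `N` steps. -/
def hitWithin {m : ℕ} (T : Fin m → ℝ → ℝ) (ω : Om m) (U : Set ℝ) (N : ℕ) : Set ℝ :=
  {x | ∃ k : ℕ, 1 ≤ k ∧ k ≤ N ∧ randComp T ω k x ∈ U}


structure Nice (F : ℝ → ℝ) (B : Finset ℝ) (L K : ℝ) : Prop where
  h0 : (0:ℝ) ∈ B
  h1 : (1:ℝ) ∈ B
  sub : ∀ b ∈ B, b ∈ Set.Icc (0:ℝ) 1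
  maps : Set.MapsTo F (Set.Icc 0 1) (Set.Icc 0 1)
  diff : ∀ x ∈ Set.Icc (0:ℝ) 1, x ∉ B → DifferentiableAt ℝ F x ∧ L ≤ |deriv F x|
  dist : ∀ x y, x ∈ Set.Icc (0:ℝ) 1 → y ∈ Set.Icc (0:ℝ) 1 → x ≤ y →
    (∀ z ∈ Set.Icc x y, z ∉ B) →
    |(Real.log |deriv F x| - Real.log |deriv F y|)| ≤ K * |F x - F y|

lemma Nice.monoK {F : ℝ → ℝ} {B : Finset ℝ} {L K K' : ℝ} (h : Nice F B L K) (hK : K ≤ K') :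
    Nice F B L K' where
  h0 := h.h0
  h1 := h.h1
  sub := h.sub
  maps := h.maps
  diff := h.diff
  dist := fun x y hx hy hxy hz => (h.dist x y hx hy hxy hz).trans
    (mul_le_mul_of_nonneg_right hK (abs_nonneg _))

def PP (B : Finset ℝ) : Finset (ℝ × ℝ) :=
  (B ×ˢ B).filter (fun p => p.1 < p.2 ∧ ∀ z ∈ B, z ≤ p.1 ∨ p.2 ≤ z)

lemma mem_PP {B : Finset ℝ} {p : ℝ × ℝ} :
    p ∈ PP B ↔ (p.1 ∈ B ∧ p.2 ∈ B) ∧ p.1 < p.2 ∧ ∀ z ∈ B, z ≤ p.1 ∨ p.2 ≤ z := by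
  simp [PP]

lemma PP_cover {B : Finset ℝ} (h0 : (0:ℝ) ∈ B) (h1 : (1:ℝ) ∈ B) {x : ℝ}
    (hx : x ∈ Set.Icc (0:ℝ) 1) (hxB : x ∉ B) : ∃ p ∈ PP B, p.1 < x ∧ x < p.2 := by
  have hx0 : 0 < x := lt_of_le_of_ne hx.1 (fun h => hxB (h ▸ h0))
  have hx1 : x < 1 := lt_of_le_of_ne hx.2 (fun h => hxB (h ▸ h1))
  obtain ⟨b, hb, hbm⟩ := (B.filter (· < x)).exists_max_image id ⟨0, by simp [h0, hx0]⟩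
  obtain ⟨c, hc, hcm⟩ := (B.filter (x < ·)).exists_min_image id ⟨1, by simp [h1, hx1]⟩
  simp only [Finset.mem_filter, id] at hb hc hbm hcm
  refine ⟨(b, c), mem_PP.2 ⟨⟨hb.1, hc.1⟩, hb.2.trans hc.2, ?_⟩, hb.2, hc.2⟩
  intro z hz
  rcases lt_trichotomy z x with h | h | h
  · exact Or.inl (hbm z ⟨hz, h⟩)
  · exact absurd (h ▸ hz) hxB
  · exact Or.inr (hcm z ⟨hz, h⟩)

lemma PP_notMem {B : Finset ℝ} {p : ℝ × ℝ} (hp : p ∈ PP B) {x : ℝ} (h1 : p.1 < x) (h2 : x < p.2) :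
    x ∉ B := fun h => by
  rcases (mem_PP.1 hp).2.2 x h with h' | h' <;> linarith

lemma PP_parent {B B' : Finset ℝ} (h0 : (0:ℝ) ∈ B) (h1 : (1:ℝ) ∈ B) (hs : B ⊆ B')
    (hsub : ∀ b ∈ B', b ∈ Set.Icc (0:ℝ) 1) {p : ℝ × ℝ} (hp : p ∈ PP B') :
    ∃ q ∈ PP B, q.1 ≤ p.1 ∧ p.2 ≤ q.2 := by
  have hp' := mem_PP.1 hp
  have a1 := hsub _ hp'.1.1
  have a2 := hsub _ hp'.1.2
  have hlt := hp'.2.1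
  have hx : (p.1 + p.2) / 2 ∈ Set.Icc (0:ℝ) 1 := ⟨by linarith [a1.1, a2.1], by linarith [a1.2, a2.2]⟩
  have hxB : (p.1 + p.2) / 2 ∉ B' := PP_notMem hp (by linarith) (by linarith)
  obtain ⟨q, hq, q1, q2⟩ := PP_cover h0 h1 hx (fun h => hxB (hs h))
  have hq' := mem_PP.1 hq
  refine ⟨q, hq, ?_, ?_⟩
  · rcases hp'.2.2 q.1 (hs hq'.1.1) with h | h
    · exact h
    · linarith
  · rcases hp'.2.2 q.2 (hs hq'.1.2) with h | h
    · linarith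
    · exact h

lemma PP_inj1 {B : Finset ℝ} {p q : ℝ × ℝ} (hp : p ∈ PP B) (hq : q ∈ PP B) (h : p.1 = q.1) :
    p = q := by
  have hp' := mem_PP.1 hp
  have hq' := mem_PP.1 hq
  refine Prod.ext h (le_antisymm ?_ ?_)
  · rcases hp'.2.2 q.2 hq'.1.2 with h' | h' <;> linarith [hq'.2.1]
  · rcases hq'.2.2 p.2 hp'.1.2 with h' | h' <;> linarith [hp'.2.1]

lemma PP_inj2 {B : Finset ℝ} {p q : ℝ × ℝ} (hp : p ∈ PP B) (hq : q ∈ PP B) (h : p.2 = q.2) :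
    p = q := by
  have hp' := mem_PP.1 hp
  have hq' := mem_PP.1 hq
  refine Prod.ext (le_antisymm ?_ ?_) h
  · rcases hq'.2.2 p.1 hp'.1.1 with h' | h' <;> linarith [hp'.2.1]
  · rcases hp'.2.2 q.1 hq'.1.1 with h' | h' <;> linarith [hq'.2.1]

lemma PP_sum {B : Finset ℝ} (hsub : ∀ b ∈ B, b ∈ Set.Icc (0:ℝ) 1) :
    ∑ p ∈ PP B, (p.2 - p.1) ≤ 1 := by
  have hd : ((PP B : Finset (ℝ × ℝ)) : Set (ℝ × ℝ)).PairwiseDisjoint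
      (fun p : ℝ × ℝ => Set.Ioo p.1 p.2) := by
    intro p hp q hq hpq
    refine Set.disjoint_left.2 fun x hx hx' => hpq ?_
    have hp' := mem_PP.1 hp
    have hq' := mem_PP.1 hq
    refine PP_inj1 hp hq (le_antisymm ?_ ?_)
    · rcases hq'.2.2 p.1 hp'.1.1 with h' | h'
      · exact h'
      · linarith [hx.1, hx'.2]
    · rcases hp'.2.2 q.1 hq'.1.1 with h' | h'
      · exact h'
      · linarith [hx.2, hx'.1]
  have hm := measure_biUnion_finset (μ := (volume : Measure ℝ)) hd (fun p _ => measurableSet_Ioo)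
  have hle : volume (⋃ p ∈ PP B, Set.Ioo p.1 p.2) ≤ volume (Set.Icc (0:ℝ) 1) := by
    apply measure_mono
    intro x hx
    simp only [Set.mem_iUnion] at hx
    obtain ⟨p, hp, hx⟩ := hx
    have hp' := mem_PP.1 hp
    exact ⟨(hsub _ hp'.1.1).1.trans hx.1.le, hx.2.le.trans (hsub _ hp'.1.2).2⟩
  rw [hm] at hle
  simp only [Real.volume_Ioo, Real.volume_Icc] at hle
  rw [← ENNReal.ofReal_sum_of_nonneg
    (fun p hp => by linarith [(mem_PP.1 hp).2.1])] at hle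
  have := (ENNReal.ofReal_le_ofReal_iff (by norm_num)).1 hle
  linarith

lemma Nice.mvt {F : ℝ → ℝ} {B : Finset ℝ} {L K : ℝ} (h : Nice F B L K) {x y : ℝ}
    (hx : x ∈ Set.Icc (0:ℝ) 1) (hy : y ∈ Set.Icc (0:ℝ) 1) (hxy : x < y)
    (hz : ∀ z ∈ Set.Icc x y, z ∉ B) :
    ∃ ξ ∈ Set.Ioo x y, |F x - F y| = |deriv F ξ| * (y - x) := by
  have hsub : ∀ z ∈ Set.Icc x y, z ∈ Set.Icc (0:ℝ) 1 := fun z hz =>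
    ⟨hx.1.trans hz.1, hz.2.trans hy.2⟩
  obtain ⟨c, hc, he⟩ := exists_deriv_eq_slope F hxy
    (fun z hzz => (h.diff z (hsub z hzz) (hz z hzz)).1.continuousAt.continuousWithinAt)
    (fun z hzz => (h.diff z (hsub z ⟨hzz.1.le, hzz.2.le⟩)
      (hz z ⟨hzz.1.le, hzz.2.le⟩)).1.differentiableWithinAt)
  refine ⟨c, hc, ?_⟩
  rw [he, abs_div, abs_of_pos (sub_pos.2 hxy), div_mul_cancel₀ _ (sub_pos.2 hxy).ne', abs_sub_comm]

lemma Nice.expand {F : ℝ → ℝ} {B : Finset ℝ} {L K : ℝ} (h : Nice F B L K) {x y : ℝ}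
    (hx : x ∈ Set.Icc (0:ℝ) 1) (hy : y ∈ Set.Icc (0:ℝ) 1) (hxy : x ≤ y)
    (hz : ∀ z ∈ Set.Icc x y, z ∉ B) : L * |x - y| ≤ |F x - F y| := by
  rcases hxy.eq_or_lt with rfl | hlt
  · simp
  obtain ⟨ξ, hξ, he⟩ := h.mvt hx hy hlt hz
  rw [he, abs_sub_comm, abs_of_pos (sub_pos.2 hlt)]
  exact mul_le_mul_of_nonneg_right (h.diff ξ ⟨hx.1.trans hξ.1.le, hξ.2.le.trans hy.2⟩
    (hz ξ ⟨hξ.1.le, hξ.2.le⟩)).2 (sub_pos.2 hlt).le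

lemma Nice.comp {F G : ℝ → ℝ} {B B' : Finset ℝ} {L K L' K' : ℝ} (h : Nice F B L K)
    (h' : Nice G B' L' K') (hL : 0 < L) (hL' : 0 < L') (hK : 0 ≤ K) (hK' : 0 ≤ K') :
    ∃ B'' : Finset ℝ, Nice (G ∘ F) B'' (L' * L) (K' + K / L') ∧ B ⊆ B'' ∧
      (∀ b ∈ B'', b ∉ B → F b ∈ B') ∧ (∀ x ∈ Set.Icc (0:ℝ) 1, F x ∈ B' → x ∈ B'') := by
  have hfin : ({x | x ∈ Set.Icc (0:ℝ) 1 ∧ x ∉ B ∧ F x ∈ B'} : Set ℝ).Finite := by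
    have : ({x | x ∈ Set.Icc (0:ℝ) 1 ∧ x ∉ B ∧ F x ∈ B'} : Set ℝ) ⊆
        ⋃ p ∈ (PP B : Set (ℝ × ℝ)), ⋃ v ∈ (B' : Set ℝ), {x | x ∈ Set.Ioo p.1 p.2 ∧ F x = v} := by
      rintro x ⟨hx, hxB, hv⟩
      obtain ⟨p, hp, hp1, hp2⟩ := PP_cover h.h0 h.h1 hx hxB
      simp only [Set.mem_iUnion]
      exact ⟨p, hp, F x, hv, ⟨hp1, hp2⟩, rfl⟩
    refine Set.Finite.subset (Set.Finite.biUnion (Finset.finite_toSet _) fun p hp =>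
      Set.Finite.biUnion (Finset.finite_toSet _) fun v _ => Set.Subsingleton.finite ?_) this
    have key : ∀ x y, x ∈ Set.Ioo p.1 p.2 → y ∈ Set.Ioo p.1 p.2 → x < y → F x = F y → False := by
      intro x y hx hy hxy he
      have hp' := mem_PP.1 hp
      have e := h.expand (x := x) (y := y)
        ⟨(h.sub _ hp'.1.1).1.trans hx.1.le, hx.2.le.trans (h.sub _ hp'.1.2).2⟩
        ⟨(h.sub _ hp'.1.1).1.trans hy.1.le, hy.2.le.trans (h.sub _ hp'.1.2).2⟩ hxy.le
        (fun z hz => PP_notMem hp (hx.1.trans_le hz.1) (hz.2.trans_lt hy.2))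
      rw [he, sub_self, abs_zero] at e
      have : 0 < L * |x - y| := mul_pos hL (abs_pos.2 (sub_ne_zero.2 hxy.ne))
      linarith
    rintro x ⟨hx, hxv⟩ y ⟨hy, hyv⟩
    rcases lt_trichotomy x y with hl | hl | hl
    · exact (key x y hx hy hl (hxv.trans hyv.symm)).elim
    · exact hl
    · exact (key y x hy hx hl (hyv.trans hxv.symm)).elim
  have hmem : ∀ x, x ∈ B ∪ hfin.toFinset ↔ x ∈ B ∨ (x ∈ Set.Icc (0:ℝ) 1 ∧ x ∉ B ∧ F x ∈ B') := by
    intro x; simp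
  have hpre : ∀ x ∈ Set.Icc (0:ℝ) 1, F x ∈ B' → x ∈ B ∪ hfin.toFinset := by
    intro x hx hv
    rw [hmem]
    by_cases hxB : x ∈ B
    · exact Or.inl hxB
    · exact Or.inr ⟨hx, hxB, hv⟩
  have hBs : B ⊆ B ∪ hfin.toFinset := Finset.subset_union_left
  have hderiv : ∀ x ∈ Set.Icc (0:ℝ) 1, x ∉ B ∪ hfin.toFinset →
      DifferentiableAt ℝ (G ∘ F) x ∧ deriv (G ∘ F) x = deriv G (F x) * deriv F x := by
    intro x hx hxn
    have d1 := (h.diff x hx (fun hh => hxn (hBs hh))).1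
    have d2 := (h'.diff (F x) (h.maps hx) (fun hh => hxn (hpre x hx hh))).1
    exact ⟨d2.comp x d1, deriv_comp x d2 d1⟩
  refine ⟨B ∪ hfin.toFinset, ?_, hBs, ?_, hpre⟩
  · refine ⟨hBs h.h0, hBs h.h1, ?_, h'.maps.comp h.maps, ?_, ?_⟩
    · intro b hb
      rcases (hmem b).1 hb with hb | hb
      · exact h.sub b hb
      · exact hb.1
    · intro x hx hxn
      refine ⟨(hderiv x hx hxn).1, ?_⟩
      rw [(hderiv x hx hxn).2, abs_mul]
      exact mul_le_mul (h'.diff (F x) (h.maps hx) (fun hh => hxn (hpre x hx hh))).2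
        (h.diff x hx (fun hh => hxn (hBs hh))).2 hL.le (abs_nonneg _)
    · intro x y hx hy hxy hz
      have hI : ∀ z ∈ Set.Icc x y, z ∈ Set.Icc (0:ℝ) 1 := fun z hz =>
        ⟨hx.1.trans hz.1, hz.2.trans hy.2⟩
      have hxn := hz x ⟨le_rfl, hxy⟩
      have hyn := hz y ⟨hxy, le_rfl⟩
      have hzB : ∀ z ∈ Set.Icc x y, z ∉ B := fun z hzz hh => hz z hzz (hBs hh)
      have hcont : ContinuousOn F (Set.uIcc x y) := by
        rw [Set.uIcc_of_le hxy]
        exact fun z hzz => (h.diff z (hI z hzz) (hzB z hzz)).1.continuousAt.continuousWithinAt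
      have hivt := intermediate_value_uIcc hcont
      have hav : ∀ w ∈ Set.uIcc (F x) (F y), w ∉ B' := by
        intro w hw hwB
        obtain ⟨z, hzz, rfl⟩ := hivt hw
        rw [Set.uIcc_of_le hxy] at hzz
        exact hz z hzz (hpre z (hI z hzz) hwB)
      have hG : |(Real.log |deriv G (F x)| - Real.log |deriv G (F y)|)| ≤ K' * |G (F x) - G (F y)| ∧
          L' * |F x - F y| ≤ |G (F x) - G (F y)| := by
        rcases le_total (F x) (F y) with hl | hl
        · rw [Set.uIcc_of_le hl] at hav
          exact ⟨h'.dist _ _ (h.maps hx) (h.maps hy) hl hav,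
            h'.expand (h.maps hx) (h.maps hy) hl hav⟩
        · rw [Set.uIcc_of_ge hl] at hav
          have := h'.dist _ _ (h.maps hy) (h.maps hx) hl hav
          have h2 := h'.expand (h.maps hy) (h.maps hx) hl hav
          rw [abs_sub_comm, abs_sub_comm (G (F y))] at this
          rw [abs_sub_comm, abs_sub_comm (G (F y))] at h2
          exact ⟨this, h2⟩
      have hF := h.dist x y hx hy hxy hzB
      have ne : ∀ t ∈ Set.Icc x y, |deriv G (F t)| ≠ 0 ∧ |deriv F t| ≠ 0 := fun t ht =>
        ⟨(hL'.trans_le (h'.diff (F t) (h.maps (hI t ht))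
          (fun hh => hz t ht (hpre t (hI t ht) hh))).2).ne',
         (hL.trans_le (h.diff t (hI t ht) (hzB t ht)).2).ne'⟩
      rw [(hderiv x hx hxn).2, (hderiv y hy hyn).2, abs_mul, abs_mul,
        Real.log_mul (ne x ⟨le_rfl, hxy⟩).1 (ne x ⟨le_rfl, hxy⟩).2,
        Real.log_mul (ne y ⟨hxy, le_rfl⟩).1 (ne y ⟨hxy, le_rfl⟩).2]
      have h3 : K * |F x - F y| ≤ K / L' * |G (F x) - G (F y)| := by
        calc K * |F x - F y| = K / L' * (L' * |F x - F y|) := by field_simp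
          _ ≤ _ := mul_le_mul_of_nonneg_left hG.2 (by positivity)
      have h4 := abs_add_le (Real.log |deriv G (F x)| - Real.log |deriv G (F y)|)
        (Real.log |deriv F x| - Real.log |deriv F y|)
      simp only [Function.comp]
      calc _ = |(Real.log |deriv G (F x)| - Real.log |deriv G (F y)|) +
        (Real.log |deriv F x| - Real.log |deriv F y|)| := by congr 1; ring
        _ ≤ _ := by linarith [hG.1]
  · intro b hb hbB
    rcases (hmem b).1 hb with hb | hb
    · exact absurd hb hbB
    · exact hb.2.2

def wt (F : ℝ → ℝ) (p : ℝ × ℝ) : ℝ := |deriv F ((p.1 + p.2) / 2)|⁻¹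

lemma wt_nonneg (F : ℝ → ℝ) (p : ℝ × ℝ) : 0 ≤ wt F p := inv_nonneg.2 (abs_nonneg _)

def ZZ (F : ℝ → ℝ) (B : Finset ℝ) : ℝ := ∑ p ∈ PP B, wt F p

lemma Nice.distort {F : ℝ → ℝ} {B : Finset ℝ} {L K : ℝ} (h : Nice F B L K) (hL : 0 < L)
    (hK : 0 ≤ K) {p : ℝ × ℝ} (hp : p ∈ PP B) {x y : ℝ} (hx : x ∈ Set.Ioo p.1 p.2)
    (hy : y ∈ Set.Ioo p.1 p.2) : |deriv F x|⁻¹ ≤ Real.exp K * |deriv F y|⁻¹ := by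
  have hp' := mem_PP.1 hp
  have hI : ∀ x ∈ Set.Ioo p.1 p.2, x ∈ Set.Icc (0:ℝ) 1 := fun x hx =>
    ⟨(h.sub _ hp'.1.1).1.trans hx.1.le, hx.2.le.trans (h.sub _ hp'.1.2).2⟩
  have hpos : ∀ x ∈ Set.Ioo p.1 p.2, 0 < |deriv F x| := fun x hx =>
    hL.trans_le (h.diff x (hI x hx) (PP_notMem hp hx.1 hx.2)).2
  have key : |(Real.log |deriv F x| - Real.log |deriv F y|)| ≤ K * |F x - F y| := by
    rcases le_total x y with hl | hl
    · exact h.dist x y (hI x hx) (hI y hy) hl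
        (fun z hz => PP_notMem hp (hx.1.trans_le hz.1) (hz.2.trans_lt hy.2))
    · rw [abs_sub_comm, abs_sub_comm (F x)]
      exact h.dist y x (hI y hy) (hI x hx) hl
        (fun z hz => PP_notMem hp (hy.1.trans_le hz.1) (hz.2.trans_lt hx.2))
  have h1 : |F x - F y| ≤ 1 := by
    have a := h.maps (hI x hx)
    have b := h.maps (hI y hy)
    rw [abs_le]; constructor <;> linarith [a.1, a.2, b.1, b.2]
  have h2 : Real.log |deriv F y| - Real.log |deriv F x| ≤ K := by
    have := (abs_le.1 key).1
    nlinarith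
  have h3 : |deriv F y| ≤ Real.exp K * |deriv F x| := by
    rw [← Real.exp_log (hpos y hy)]
    conv_rhs => rw [← Real.exp_log (hpos x hx)]
    rw [← Real.exp_add]
    exact Real.exp_le_exp.2 (by linarith)
  have p1 := hpos x hx
  have p2 := hpos y hy
  rw [inv_le_iff_one_le_mul₀ p1]
  rw [mul_assoc, mul_comm, mul_assoc, ← div_eq_inv_mul, le_div_iff₀ p2]
  linarith

lemma Nice.step {F G : ℝ → ℝ} {B B' B'' : Finset ℝ} {L K L' K' L₂ K₂ δ : ℝ} (h : Nice F B L K)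
    (h' : Nice G B' L' K') (h'' : Nice (G ∘ F) B'' L₂ K₂) (hL : 0 < L) (hL' : 0 < L')
    (hK : 0 ≤ K) (hδ : 0 < δ)
    (hgap : ∀ u ∈ B', ∀ v ∈ B', u ≠ v → δ ≤ |u - v|)
    (hs : B ⊆ B'') (hpre : ∀ b ∈ B'', b ∉ B → F b ∈ B')
    (hpre' : ∀ x ∈ Set.Icc (0:ℝ) 1, F x ∈ B' → x ∈ B'') :
    ZZ (G ∘ F) B'' ≤ 2 * Real.exp K / L' * ZZ F B + Real.exp K / (δ * L') := by
  classical
  have hpar : ∀ p : ℝ × ℝ, ∃ q : ℝ × ℝ, p ∈ PP B'' → q ∈ PP B ∧ q.1 ≤ p.1 ∧ p.2 ≤ q.2 := by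
    intro p
    by_cases hp : p ∈ PP B''
    · obtain ⟨q, hq⟩ := PP_parent h.h0 h.h1 hs h''.sub hp
      exact ⟨q, fun _ => hq⟩
    · exact ⟨p, fun hh => absurd hh hp⟩
  choose par hpar using hpar
  have hw0 : ∀ p ∈ PP B'', wt (G ∘ F) p ≤ (L')⁻¹ * wt F p := by
    intro p hp
    have hp' := mem_PP.1 hp
    have a1 := h''.sub _ hp'.1.1
    have a2 := h''.sub _ hp'.1.2
    have hlt := hp'.2.1
    have hx : (p.1 + p.2) / 2 ∈ Set.Icc (0:ℝ) 1 :=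
      ⟨by linarith [a1.1, a2.1], by linarith [a1.2, a2.2]⟩
    have hxB : (p.1 + p.2) / 2 ∉ B'' := PP_notMem hp (by linarith) (by linarith)
    have d1 := (h.diff _ hx (fun hh => hxB (hs hh))).1
    have d2 := h'.diff _ (h.maps hx) (fun hh => hxB (hpre' _ hx hh))
    unfold wt
    rw [deriv_comp _ d2.1 d1, abs_mul, mul_inv]
    exact mul_le_mul_of_nonneg_right (inv_anti₀ hL' d2.2) (inv_nonneg.2 (abs_nonneg _))
  have hw1 : ∀ p ∈ PP B'', wt (G ∘ F) p ≤ Real.exp K / L' * wt F (par p) := by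
    intro p hp
    obtain ⟨q0, q1, q2⟩ := hpar p hp
    have hlt := (mem_PP.1 hp).2.1
    have hlt' := (mem_PP.1 q0).2.1
    have := h.distort hL hK q0 (x := (p.1 + p.2) / 2) (y := ((par p).1 + (par p).2) / 2)
      ⟨by linarith, by linarith⟩ ⟨by linarith, by linarith⟩
    calc _ ≤ _ := hw0 p hp
      _ ≤ (L')⁻¹ * (Real.exp K * wt F (par p)) :=
        mul_le_mul_of_nonneg_left this (inv_nonneg.2 hL'.le)
      _ = _ := by ring
  have hw2 : ∀ p ∈ PP B'', p.1 ∉ B → p.2 ∉ B →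
      wt (G ∘ F) p ≤ Real.exp K / (δ * L') * (p.2 - p.1) := by
    intro p hp n1 n2
    obtain ⟨q0, q1, q2⟩ := hpar p hp
    have hp' := mem_PP.1 hp
    have hlt := hp'.2.1
    have a1 := h''.sub _ hp'.1.1
    have a2 := h''.sub _ hp'.1.2
    have hno : ∀ z ∈ Set.Icc p.1 p.2, z ∉ B := by
      intro z hz hzB
      rcases hp'.2.2 z (hs hzB) with hh | hh
      · exact n1 (le_antisymm hh hz.1 ▸ hzB)
      · exact n2 (le_antisymm hz.2 hh ▸ hzB)
    obtain ⟨ξ, hξ, he⟩ := h.mvt a1 a2 hlt hno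
    have hξpos : 0 < |deriv F ξ| := hL.trans_le (h.diff ξ ⟨a1.1.trans hξ.1.le, hξ.2.le.trans a2.2⟩
      (hno ξ ⟨hξ.1.le, hξ.2.le⟩)).2
    have hne : F p.1 ≠ F p.2 := by
      intro hh
      rw [hh, sub_self, abs_zero] at he
      have : 0 < |deriv F ξ| * (p.2 - p.1) := mul_pos hξpos (by linarith)
      linarith
    have hg := hgap _ (hpre _ hp'.1.1 n1) _ (hpre _ hp'.1.2 n2) hne
    rw [he] at hg
    have h1 : |deriv F ξ|⁻¹ ≤ (p.2 - p.1) / δ := by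
      rw [le_div_iff₀ hδ, inv_mul_le_iff₀ hξpos]
      exact hg
    have h2 := h.distort hL hK q0 (x := (p.1 + p.2) / 2) (y := ξ)
      ⟨by linarith, by linarith⟩ ⟨by linarith [hξ.1], by linarith [hξ.2]⟩
    calc _ ≤ _ := hw0 p hp
      _ ≤ (L')⁻¹ * (Real.exp K * ((p.2 - p.1) / δ)) :=
        mul_le_mul_of_nonneg_left (h2.trans (mul_le_mul_of_nonneg_left h1 (Real.exp_pos _).le))
          (inv_nonneg.2 hL'.le)
      _ = _ := by field_simp
  have hD : 0 ≤ Real.exp K / L' := by positivity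
  have hsum : ∀ S : Finset (ℝ × ℝ), S ⊆ PP B'' → Set.InjOn par S →
      ∑ p ∈ S, Real.exp K / L' * wt F (par p) ≤ Real.exp K / L' * ZZ F B := by
    intro S hS hinj
    rw [← Finset.mul_sum]
    refine mul_le_mul_of_nonneg_left ?_ hD
    rw [← Finset.sum_image (f := fun q => wt F q) hinj]
    refine Finset.sum_le_sum_of_subset_of_nonneg ?_ (fun q _ _ => wt_nonneg F q)
    intro q hq
    obtain ⟨p, hp, rfl⟩ := Finset.mem_image.1 hq
    exact (hpar p (hS hp)).1
  have i1 := hsum ((PP B'').filter (fun p => p.1 ∈ B)) (Finset.filter_subset _ _) (by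
    intro p hp p' hp' he
    simp only [Finset.coe_filter, Set.mem_setOf_eq] at hp hp'
    have key : ∀ p, p ∈ PP B'' → p.1 ∈ B → p.1 = (par p).1 := by
      intro p hp hB
      obtain ⟨q0, q1, q2⟩ := hpar p hp
      have hlt := (mem_PP.1 hp).2.1
      rcases (mem_PP.1 q0).2.2 _ hB with hh | hh <;> linarith
    exact PP_inj1 hp.1 hp'.1 (by rw [key p hp.1 hp.2, key p' hp'.1 hp'.2, he]))
  have i2 := hsum ((PP B'').filter (fun p => p.2 ∈ B)) (Finset.filter_subset _ _) (by
    intro p hp p' hp' he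
    simp only [Finset.coe_filter, Set.mem_setOf_eq] at hp hp'
    have key : ∀ p, p ∈ PP B'' → p.2 ∈ B → p.2 = (par p).2 := by
      intro p hp hB
      obtain ⟨q0, q1, q2⟩ := hpar p hp
      have hlt := (mem_PP.1 hp).2.1
      rcases (mem_PP.1 q0).2.2 _ hB with hh | hh <;> linarith
    exact PP_inj2 hp.1 hp'.1 (by rw [key p hp.1 hp.2, key p' hp'.1 hp'.2, he]))
  have i3 : ∑ p ∈ PP B'', Real.exp K / (δ * L') * (p.2 - p.1) ≤ Real.exp K / (δ * L') := by
    rw [← Finset.mul_sum]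
    exact mul_le_of_le_one_right (by positivity) (PP_sum h''.sub)
  have hpt : ∀ p ∈ PP B'', wt (G ∘ F) p ≤
      (if p.1 ∈ B then Real.exp K / L' * wt F (par p) else 0) +
      (if p.2 ∈ B then Real.exp K / L' * wt F (par p) else 0) +
      Real.exp K / (δ * L') * (p.2 - p.1) := by
    intro p hp
    have e1 : 0 ≤ Real.exp K / L' * wt F (par p) := mul_nonneg hD (wt_nonneg _ _)
    have e2 : 0 ≤ Real.exp K / (δ * L') * (p.2 - p.1) :=
      mul_nonneg (by positivity) (by linarith [(mem_PP.1 hp).2.1])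
    have e3 := hw1 p hp
    by_cases c1 : p.1 ∈ B <;> by_cases c2 : p.2 ∈ B <;> simp only [c1, c2, if_true, if_false]
    · linarith
    · linarith
    · linarith
    · linarith [hw2 p hp c1 c2]
  have := Finset.sum_le_sum hpt
  rw [Finset.sum_add_distrib, Finset.sum_add_distrib, ← Finset.sum_filter, ← Finset.sum_filter] at this
  calc ZZ (G ∘ F) B'' ≤ _ := this
    _ ≤ Real.exp K / L' * ZZ F B + Real.exp K / L' * ZZ F B + Real.exp K / (δ * L') := by
      linarith
    _ = _ := by ring

lemma Nice.short {F : ℝ → ℝ} {B : Finset ℝ} {L K lam ε : ℝ} (h : Nice F B L K)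
    (hK : 0 ≤ K) (hlam : 1 < lam) (hL : lam ≤ L) (hε : 0 ≤ ε) :
    volume {x | x ∈ Set.Icc (0:ℝ) 1 ∧ |F x - x| ≤ ε} ≤
      ENNReal.ofReal (2 * ε * (lam / (lam - 1)) * Real.exp K * ZZ F B) := by
  have hL0 : 0 < L := by linarith
  have hl : 0 < lam - 1 := by linarith
  set c := 2 * ε * (lam / (lam - 1)) * Real.exp K with hc
  have hc0 : 0 ≤ c := by positivity
  have hcov : {x | x ∈ Set.Icc (0:ℝ) 1 ∧ |F x - x| ≤ ε} ⊆
      (B : Set ℝ) ∪ ⋃ p ∈ PP B, {x | x ∈ Set.Ioo p.1 p.2 ∧ |F x - x| ≤ ε} := by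
    rintro x ⟨hx, hxe⟩
    by_cases hB : x ∈ B
    · exact Or.inl hB
    · obtain ⟨p, hp, p1, p2⟩ := PP_cover h.h0 h.h1 hx hB
      refine Or.inr ?_
      simp only [Set.mem_iUnion]
      exact ⟨p, hp, ⟨p1, p2⟩, hxe⟩
  have hone : ∀ p ∈ PP B, volume {x | x ∈ Set.Ioo p.1 p.2 ∧ |F x - x| ≤ ε} ≤
      ENNReal.ofReal (c * wt F p) := by
    intro p hp
    have hp' := mem_PP.1 hp
    have hlt := hp'.2.1
    have key : ∀ x y, x ∈ Set.Ioo p.1 p.2 → y ∈ Set.Ioo p.1 p.2 → x < y → |F x - x| ≤ ε →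
        |F y - y| ≤ ε → y - x ≤ c * wt F p := by
      intro x y hx hy hxy ex ey
      obtain ⟨ξ, hξ, he⟩ := h.mvt (x := x) (y := y)
        ⟨(h.sub _ hp'.1.1).1.trans hx.1.le, hx.2.le.trans (h.sub _ hp'.1.2).2⟩
        ⟨(h.sub _ hp'.1.1).1.trans hy.1.le, hy.2.le.trans (h.sub _ hp'.1.2).2⟩ hxy
        (fun z hz => PP_notMem hp (hx.1.trans_le hz.1) (hz.2.trans_lt hy.2))
      have hξI : ξ ∈ Set.Ioo p.1 p.2 := ⟨hx.1.trans hξ.1, hξ.2.trans hy.2⟩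
      have hξL : lam ≤ |deriv F ξ| := hL.trans (h.diff ξ
        ⟨(h.sub _ hp'.1.1).1.trans hξI.1.le, hξI.2.le.trans (h.sub _ hp'.1.2).2⟩
        (PP_notMem hp hξI.1 hξI.2)).2
      have hd := h.distort hL0 hK hp (x := ξ) (y := (p.1 + p.2) / 2) hξI
        ⟨by linarith, by linarith⟩
      have h1 : |F x - F y| ≤ 2 * ε + (y - x) := by
        rw [abs_le] at ex ey ⊢
        constructor <;> linarith [ex.1, ex.2, ey.1, ey.2]
      rw [he] at h1
      have hDpos : 0 < |deriv F ξ| := by linarith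
      have h2 : (lam - 1) / lam * |deriv F ξ| ≤ |deriv F ξ| - 1 := by
        have : |deriv F ξ| / lam ≥ 1 := by
          rw [ge_iff_le, le_div_iff₀ (by linarith)]; linarith
        have e : (lam - 1) / lam * |deriv F ξ| = |deriv F ξ| - |deriv F ξ| / lam := by
          field_simp
        linarith
      have h3 : (lam - 1) / lam * |deriv F ξ| * (y - x) ≤ 2 * ε := by
        have := mul_le_mul_of_nonneg_right h2 (sub_pos.2 hxy).le
        linarith
      have h4 : y - x ≤ 2 * ε * (lam / (lam - 1)) * |deriv F ξ|⁻¹ := by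
        have e : y - x = ((lam - 1) / lam * |deriv F ξ| * (y - x)) * (lam / (lam - 1)) *
            |deriv F ξ|⁻¹ := by field_simp
        rw [e]
        gcongr
      calc y - x ≤ _ := h4
        _ ≤ 2 * ε * (lam / (lam - 1)) * (Real.exp K * wt F p) :=
          mul_le_mul_of_nonneg_left hd (by positivity)
        _ = _ := by rw [hc]; ring
    refine (Real.volume_le_diam _).trans ?_
    refine Metric.ediam_le ?_
    rintro x ⟨hx, ex⟩ y ⟨hy, ey⟩
    rw [edist_dist]
    refine ENNReal.ofReal_le_ofReal ?_
    rw [Real.dist_eq]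
    rcases lt_trichotomy x y with hh | hh | hh
    · rw [abs_sub_comm, abs_of_pos (sub_pos.2 hh)]
      exact key x y hx hy hh ex ey
    · rw [hh, sub_self, abs_zero]
      exact mul_nonneg hc0 (wt_nonneg _ _)
    · rw [abs_of_pos (sub_pos.2 hh)]
      exact key y x hy hx hh ey ex
  calc volume {x | x ∈ Set.Icc (0:ℝ) 1 ∧ |F x - x| ≤ ε} ≤ _ := measure_mono hcov
    _ ≤ volume (B : Set ℝ) + volume (⋃ p ∈ PP B, {x | x ∈ Set.Ioo p.1 p.2 ∧ |F x - x| ≤ ε}) :=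
      measure_union_le _ _
    _ ≤ 0 + ∑ p ∈ PP B, volume {x | x ∈ Set.Ioo p.1 p.2 ∧ |F x - x| ≤ ε} := by
      gcongr
      · exact (Finset.measure_zero B volume).le
      · exact measure_biUnion_finset_le _ _
    _ ≤ ∑ p ∈ PP B, ENNReal.ofReal (c * wt F p) := by
      rw [zero_add]
      exact Finset.sum_le_sum hone
    _ = ENNReal.ofReal (c * ZZ F B) := by
      rw [← ENNReal.ofReal_sum_of_nonneg (fun p _ => mul_nonneg hc0 (wt_nonneg _ _)),
        ← Finset.mul_sum]
      rfl

lemma part_cover (N : ℕ) (a : ℕ → ℝ) (x : ℝ) (h0 : a 0 ≤ x) (h1 : x < a N) :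
    ∃ i < N, a i ≤ x ∧ x < a (i + 1) := by
  induction N with
  | zero => linarith
  | succ n ih =>
    by_cases h : x < a n
    · obtain ⟨i, hi, hh⟩ := ih h
      exact ⟨i, by omega, hh⟩
    · exact ⟨n, by omega, by linarith, h1⟩

lemma part_mono (N : ℕ) (a : ℕ → ℝ) (h : ∀ i < N, a i < a (i + 1)) :
    ∀ j ≤ N, ∀ i ≤ j, a i ≤ a j := by
  intro j
  induction j with
  | zero => intro _ i hi; rw [Nat.le_zero.1 hi]
  | succ n ih =>
    intro hn i hi
    rcases Nat.lt_or_ge i (n + 1) with hh | hh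
    · exact (ih (by omega) i (by omega)).trans (h n (by omega)).le
    · rw [le_antisymm hi hh]

lemma log_lip {u v : ℝ} (hu : 1 ≤ u) (hv : 1 ≤ v) : |Real.log u - Real.log v| ≤ |u - v| := by
  have key : ∀ u v : ℝ, 1 ≤ u → u ≤ v → Real.log v - Real.log u ≤ v - u := by
    intro u v hu huv
    have hu0 : 0 < u := by linarith
    have hv0 : 0 < v := by linarith
    rw [← Real.log_div hv0.ne' hu0.ne']
    have := Real.log_le_sub_one_of_pos (div_pos hv0 hu0)
    have h2 : v / u - 1 = (v - u) / u := by field_simp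
    have h3 : (v - u) / u ≤ v - u := div_le_self (by linarith) hu
    linarith
  rcases le_total u v with h | h
  · rw [abs_sub_comm, abs_sub_comm u, abs_of_nonneg (sub_nonneg.2 h),
      abs_of_nonneg (sub_nonneg.2 (Real.log_le_log (by linarith) h))]
    exact key u v hu h
  · rw [abs_of_nonneg (sub_nonneg.2 h),
      abs_of_nonneg (sub_nonneg.2 (Real.log_le_log (by linarith) h))]
    exact key v u hv h

lemma c2_lip {g : ℝ → ℝ} {c d : ℝ} (hcd : c < d) (hg : ContDiffOn ℝ 2 g (Set.Icc c d)) :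
    ∃ K : ℝ, 0 ≤ K ∧ ∀ x ∈ Set.Icc c d, ∀ y ∈ Set.Icc c d,
      |derivWithin g (Set.Icc c d) x - derivWithin g (Set.Icc c d) y| ≤ K * |x - y| := by
  have hu := uniqueDiffOn_Icc hcd
  have h1 : ContDiffOn ℝ 1 (derivWithin g (Set.Icc c d)) (Set.Icc c d) :=
    hg.derivWithin hu (by norm_num)
  have h2 := h1.continuousOn_derivWithin hu le_rfl
  obtain ⟨K, hK⟩ := isCompact_Icc.exists_bound_of_continuousOn h2
  refine ⟨K, (norm_nonneg _).trans (hK c ⟨le_rfl, hcd.le⟩), fun x hx y hy => ?_⟩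
  have := (convex_Icc c d).norm_image_sub_le_of_norm_derivWithin_le
    (h1.differentiableOn (by norm_num)) hK hy hx
  simpa [Real.norm_eq_abs] using this

lemma pw_nice {T : ℝ → ℝ} {lam : ℝ} (hlam : 1 < lam) (hT : PiecewiseC2Expanding T lam)
    (hm : Set.MapsTo T (Set.Icc 0 1) (Set.Icc 0 1)) :
    ∃ (B : Finset ℝ) (K : ℝ), 0 ≤ K ∧ Nice T B lam K := by
  classical
  obtain ⟨N, a, hN, ha0, haN, hlt, hg⟩ := hT
  have hmono := part_mono N a hlt
  have hK : ∃ K : ℝ, 0 ≤ K ∧ ∀ i < N, ∀ x ∈ Set.Ioo (a i) (a (i + 1)),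
      ∀ y ∈ Set.Ioo (a i) (a (i + 1)), |deriv T x - deriv T y| ≤ K * |x - y| := by
    have : ∀ i, ∃ K : ℝ, 0 ≤ K ∧ (i < N → ∀ x ∈ Set.Ioo (a i) (a (i + 1)),
      ∀ y ∈ Set.Ioo (a i) (a (i + 1)), |deriv T x - deriv T y| ≤ K * |x - y|) := by
      intro i
      by_cases hi : i < N
      · obtain ⟨g, g1, g2, g3, g4⟩ := hg i hi
        obtain ⟨K, hK0, hK⟩ := c2_lip (hlt i hi) g1
        refine ⟨K, hK0, fun _ x hx y hy => ?_⟩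
        have e : ∀ x ∈ Set.Ioo (a i) (a (i + 1)),
            deriv T x = derivWithin g (Set.Icc (a i) (a (i + 1))) x := by
          intro x hx
          rw [derivWithin_of_mem_nhds (Icc_mem_nhds hx.1 hx.2)]
          exact (g2.eventuallyEq_of_mem (Ioo_mem_nhds hx.1 hx.2)).deriv_eq
        rw [e x hx, e y hy]
        exact hK x ⟨hx.1.le, hx.2.le⟩ y ⟨hy.1.le, hy.2.le⟩
      · exact ⟨0, le_rfl, fun h => absurd h hi⟩
    choose Kf hKf using this
    refine ⟨∑ i ∈ Finset.range N, Kf i, Finset.sum_nonneg fun i _ => (hKf i).1, ?_⟩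
    intro i hi x hx y hy
    refine ((hKf i).2 hi x hx y hy).trans (mul_le_mul_of_nonneg_right ?_ (abs_nonneg _))
    exact Finset.single_le_sum (f := Kf) (fun i _ => (hKf i).1) (Finset.mem_range.2 hi)
  obtain ⟨K, hK0, hK⟩ := hK
  have hmemB : ∀ i ≤ N, a i ∈ (Finset.range (N + 1)).image a := fun i hi =>
    Finset.mem_image.2 ⟨i, Finset.mem_range.2 (by omega), rfl⟩
  have hB0 : (0:ℝ) ∈ (Finset.range (N + 1)).image a := ha0 ▸ hmemB 0 (by omega)
  have hB1 : (1:ℝ) ∈ (Finset.range (N + 1)).image a := haN ▸ hmemB N le_rfl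
  have hloc : ∀ x ∈ Set.Icc (0:ℝ) 1, x ∉ (Finset.range (N + 1)).image a →
      ∃ i < N, x ∈ Set.Ioo (a i) (a (i + 1)) := by
    intro x hx hxB
    obtain ⟨i, hi, h1, h2⟩ := part_cover N a x (by rw [ha0]; exact hx.1)
      (by rw [haN]; exact lt_of_le_of_ne hx.2 (fun h => hxB (h ▸ hB1)))
    exact ⟨i, hi, lt_of_le_of_ne h1 (fun h => hxB (h ▸ hmemB i hi.le)), h2⟩
  have hdiff : ∀ x ∈ Set.Icc (0:ℝ) 1, x ∉ (Finset.range (N + 1)).image a →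
      DifferentiableAt ℝ T x ∧ lam ≤ |deriv T x| := by
    intro x hx hxB
    obtain ⟨i, hi, hxi⟩ := hloc x hx hxB
    obtain ⟨g, g1, g2, g3, g4⟩ := hg i hi
    have hev := g2.eventuallyEq_of_mem (Ioo_mem_nhds hxi.1 hxi.2)
    have hnh := Icc_mem_nhds hxi.1 hxi.2
    have hd : DifferentiableAt ℝ g x :=
      ((g1.differentiableOn (by norm_num)) x ⟨hxi.1.le, hxi.2.le⟩).differentiableAt hnh
    refine ⟨hev.differentiableAt_iff.2 hd, ?_⟩
    rw [hev.deriv_eq, ← derivWithin_of_mem_nhds hnh]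
    exact g4 x ⟨hxi.1.le, hxi.2.le⟩
  have hbase : Nice T ((Finset.range (N + 1)).image a) lam K := by
    refine ⟨hB0, hB1, ?_, hm, hdiff, ?_⟩
    · intro b hb
      obtain ⟨i, hi, rfl⟩ := Finset.mem_image.1 hb
      have hi' : i ≤ N := by have := Finset.mem_range.1 hi; omega
      exact ⟨ha0 ▸ hmono i hi' 0 (by omega), haN ▸ hmono N le_rfl i hi'⟩
    · intro x y hx hy hxy hz
      have hI : ∀ z ∈ Set.Icc x y, z ∈ Set.Icc (0:ℝ) 1 := fun z hz =>
        ⟨hx.1.trans hz.1, hz.2.trans hy.2⟩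
      obtain ⟨i, hi, hxi⟩ := hloc x hx (hz x ⟨le_rfl, hxy⟩)
      have hyi : y ∈ Set.Ioo (a i) (a (i + 1)) := by
        refine ⟨hxi.1.trans_le hxy, ?_⟩
        by_contra hcon
        exact hz (a (i + 1)) ⟨hxi.2.le, not_lt.1 hcon⟩ (hmemB _ (by omega))
      have e1 := (hdiff x hx (hz x ⟨le_rfl, hxy⟩)).2
      have e2 := (hdiff y hy (hz y ⟨hxy, le_rfl⟩)).2
      have e3 : |x - y| ≤ |T x - T y| := by
        rcases hxy.eq_or_lt with rfl | hl
        · simp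
        obtain ⟨ξ, hξ, he⟩ := exists_deriv_eq_slope T hl
          (fun z hzz => (hdiff z (hI z hzz) (hz z hzz)).1.continuousAt.continuousWithinAt)
          (fun z hzz => (hdiff z (hI z ⟨hzz.1.le, hzz.2.le⟩)
            (hz z ⟨hzz.1.le, hzz.2.le⟩)).1.differentiableWithinAt)
        have e4 := (hdiff ξ (hI ξ ⟨hξ.1.le, hξ.2.le⟩) (hz ξ ⟨hξ.1.le, hξ.2.le⟩)).2
        rw [he, abs_div, le_div_iff₀ (abs_pos.2 (sub_pos.2 hl).ne')] at e4
        rw [abs_sub_comm, abs_sub_comm (T x)]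
        nlinarith [abs_nonneg (y - x)]
      calc _ ≤ _ := log_lip (by linarith) (by linarith)
        _ ≤ |deriv T x - deriv T y| := abs_abs_sub_abs_le _ _
        _ ≤ K * |x - y| := hK i hi x hxi y hyi
        _ ≤ _ := mul_le_mul_of_nonneg_left e3 hK0
  exact ⟨_, K, hK0, hbase⟩

lemma rand_nice {m : ℕ} {T : Fin m → ℝ → ℝ} {lam K0 : ℝ} (hlam : 1 < lam) (hK0 : 0 ≤ K0)
    (hT : ∀ i, ∃ B, Nice (T i) B lam K0) (ω : Om m) (n : ℕ) :
    ∃ B, Nice (randComp T ω n) B (lam ^ n) (K0 * lam / (lam - 1)) := by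
  have hl : 0 < lam - 1 := by linarith
  have hK1 : 0 ≤ K0 * lam / (lam - 1) := by positivity
  induction n with
  | zero =>
    refine ⟨{0, 1}, by simp, by simp, ?_, ?_, ?_, ?_⟩
    · intro b hb
      simp only [Finset.mem_insert, Finset.mem_singleton] at hb
      rcases hb with rfl | rfl <;> simp
    · intro x hx; exact hx
    · intro x _ _
      simp [randComp]
    · intro x y _ _ _ _
      simp only [randComp, deriv_id'', sub_self, abs_zero]
      positivity
  | succ n ih =>
    obtain ⟨B, hB⟩ := ih
    obtain ⟨B', hB'⟩ := hT (ω (n : ℤ))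
    obtain ⟨B'', h, -⟩ := hB.comp hB' (by positivity) (by linarith) hK1 hK0
    refine ⟨B'', ?_⟩
    have e : K0 + K0 * lam / (lam - 1) / lam = K0 * lam / (lam - 1) := by field_simp; ring
    rw [e, ← pow_succ'] at h
    exact h

lemma rand_finite {m : ℕ} (T : Fin m → ℝ → ℝ) (n : ℕ) :
    {F | ∃ ω : Om m, F = randComp T ω n}.Finite := by
  induction n with
  | zero =>
    refine (Set.finite_singleton (fun x : ℝ => x)).subset ?_
    rintro F ⟨ω, rfl⟩
    rfl
  | succ n ih =>
    refine (Set.Finite.image2 (fun (i : Fin m) F => T i ∘ F) Set.finite_univ ih).subset ?_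
    rintro F ⟨ω, rfl⟩
    exact ⟨ω (n : ℤ), trivial, randComp T ω n, ⟨ω, rfl⟩, rfl⟩

lemma shift_iter {m : ℕ} (ω : Om m) (n : ℕ) (k : ℤ) : (shift^[n] ω) k = ω (k + n) := by
  induction n generalizing ω with
  | zero => simp
  | succ n ih =>
    rw [Function.iterate_succ_apply, ih]
    simp only [shift]
    congr 1
    push_cast
    ring

lemma rand_add {m : ℕ} (T : Fin m → ℝ → ℝ) (ω : Om m) (n p : ℕ) :
    randComp T ω (n + p) = randComp T (shift^[n] ω) p ∘ randComp T ω n := by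
  induction p with
  | zero => rfl
  | succ p ih =>
    funext x
    have := congrFun ih x
    rw [← add_assoc]
    simp only [randComp, Function.comp] at this ⊢
    rw [this, shift_iter]
    congr 2
    push_cast
    ring

lemma fin_unif {α : Type*} {S : Set α} (hS : S.Finite) (P : α → ℝ → Prop)
    (hmono : ∀ F C C', C ≤ C' → P F C → P F C') (h : ∀ F ∈ S, ∃ C, P F C) :
    ∃ C, ∀ F ∈ S, P F C := by
  have : ∀ F, ∃ C, F ∈ S → P F C := by
    intro F
    by_cases hF : F ∈ S
    · obtain ⟨C, hC⟩ := h F hF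
      exact ⟨C, fun _ => hC⟩
    · exact ⟨0, fun hh => absurd hh hF⟩
  choose c hc using this
  obtain ⟨C, hC⟩ := (hS.image c).bddAbove
  exact ⟨C, fun F hF => hmono F _ _ (hC (Set.mem_image_of_mem c hF)) (hc F hF)⟩

lemma gap_exists (B : Finset ℝ) :
    ∃ C : ℝ, 0 < C ∧ ∀ u ∈ B, ∀ v ∈ B, u ≠ v → C⁻¹ ≤ |u - v| := by
  classical
  have hn : ∀ q ∈ B.offDiag, 0 ≤ |q.1 - q.2|⁻¹ := fun q _ => inv_nonneg.2 (abs_nonneg _)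
  have h0 := Finset.sum_nonneg hn
  refine ⟨∑ q ∈ B.offDiag, |q.1 - q.2|⁻¹ + 1, by linarith, ?_⟩
  intro u hu v hv huv
  have := Finset.single_le_sum hn (Finset.mem_offDiag.2 ⟨hu, hv, huv⟩ : (u, v) ∈ B.offDiag)
  exact inv_le_of_inv_le₀ (abs_pos.2 (sub_ne_zero.2 huv)) (by simp only at this; linarith)

lemma rand_unif {m : ℕ} {T : Fin m → ℝ → ℝ} {lam K0 : ℝ} (hlam : 1 < lam) (hK0 : 0 ≤ K0)
    (hT : ∀ i, ∃ B, Nice (T i) B lam K0) :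
    ∃ K2 C : ℝ, 0 ≤ K2 ∧ 0 ≤ C ∧ ∀ (n : ℕ) (ω : Om m), ∃ B,
      Nice (randComp T ω n) B (lam ^ n) K2 ∧ ZZ (randComp T ω n) B ≤ C := by
  have hl : 0 < lam - 1 := by linarith
  have hN := rand_nice hlam hK0 hT
  set K1 := K0 * lam / (lam - 1) with hK1d
  have hK1 : 0 ≤ K1 := by positivity
  set K2 := K1 * lam / (lam - 1) with hK2d
  have hK2 : 0 ≤ K2 := by positivity
  have hK12 : K1 + K2 / lam = K2 := by rw [hK2d]; field_simp; ring
  have hK12' : K1 ≤ K2 := by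
    have : 0 ≤ K2 / lam := by positivity
    linarith
  obtain ⟨p, hp⟩ := pow_unbounded_of_one_lt (4 * Real.exp K2) hlam
  have hexp : 1 ≤ Real.exp K2 := Real.one_le_exp hK2
  have hp1 : 1 ≤ p := by
    rcases Nat.eq_zero_or_pos p with rfl | h
    · rw [pow_zero] at hp; linarith
    · exact h
  -- uniform gap
  obtain ⟨Cg, hCg⟩ := fin_unif (rand_finite T p)
    (fun F C => ∃ B, Nice F B (lam ^ p) K1 ∧ 0 < C ∧ ∀ u ∈ B, ∀ v ∈ B, u ≠ v → C⁻¹ ≤ |u - v|)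
    (by
      rintro F C C' hC ⟨B, h1, h2, h3⟩
      exact ⟨B, h1, h2.trans_le hC, fun u hu v hv huv =>
        (inv_anti₀ h2 hC).trans (h3 u hu v hv huv)⟩)
    (by
      rintro F ⟨ω, rfl⟩
      obtain ⟨B, hB⟩ := hN ω p
      obtain ⟨C, hC⟩ := gap_exists B
      exact ⟨C, B, hB, hC⟩)
  -- base
  have hbase : ∀ n, ∃ C, ∀ F ∈ {F | ∃ ω : Om m, F = randComp T ω n},
      ∃ B, Nice F B (lam ^ n) K2 ∧ ZZ F B ≤ C := by
    intro n
    refine fin_unif (rand_finite T n) (fun F C => ∃ B, Nice F B (lam ^ n) K2 ∧ ZZ F B ≤ C) ?_ ?_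
    · rintro F C C' hC ⟨B, h1, h2⟩
      exact ⟨B, h1, h2.trans hC⟩
    · rintro F ⟨ω, rfl⟩
      obtain ⟨B, hB⟩ := hN ω n
      exact ⟨_, B, hB.monoK hK12', le_rfl⟩
  choose Cb hCb using hbase
  set C0 := ∑ n ∈ Finset.range p, |Cb n| with hC0
  have hC0n : 0 ≤ C0 := Finset.sum_nonneg fun _ _ => abs_nonneg _
  set C := C0 + 2 * (Real.exp K2 * |Cg|) with hCd
  have hCn : 0 ≤ C := by positivity
  refine ⟨K2, C, hK2, hCn, ?_⟩
  intro n
  induction n using Nat.strong_induction_on with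
  | _ n ih =>
    intro ω
    rcases Nat.lt_or_ge n p with hnp | hnp
    · obtain ⟨B, h1, h2⟩ := hCb n _ ⟨ω, rfl⟩
      refine ⟨B, h1, h2.trans ?_⟩
      have a1 := Finset.single_le_sum (f := fun n => |Cb n|) (fun _ _ => abs_nonneg _)
        (Finset.mem_range.2 hnp)
      have a2 := le_abs_self (Cb n)
      have a3 : 0 ≤ 2 * (Real.exp K2 * |Cg|) := by positivity
      linarith
    · obtain ⟨k, rfl⟩ := Nat.exists_eq_add_of_le' hnp
      obtain ⟨B, h1, h2⟩ := ih k (by omega) ω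
      obtain ⟨B', g1, g2, g3⟩ := hCg _ ⟨shift^[k] ω, rfl⟩
      obtain ⟨B'', f1, f2, f3, f4⟩ := h1.comp g1 (by positivity) (by positivity) hK2 hK1
      have hst := h1.step g1 f1 (by positivity) (by positivity) hK2 (inv_pos.2 g2) g3 f2 f3 f4
      rw [← rand_add] at f1 hst
      refine ⟨B'', ?_, ?_⟩
      · rw [← pow_add, add_comm p k] at f1
        refine f1.monoK ?_
        have : K2 / lam ^ p ≤ K2 / lam := by
          refine div_le_div_of_nonneg_left hK2 (by linarith) ?_
          calc lam = lam ^ 1 := (pow_one _).symm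
            _ ≤ lam ^ p := pow_le_pow_right₀ hlam.le hp1
        linarith
      · refine hst.trans ?_
        have hLp : 0 < lam ^ p := by positivity
        have b1 : 2 * Real.exp K2 / lam ^ p ≤ 1 / 2 := by
          rw [div_le_iff₀ hLp]; linarith
        have b2 : 2 * Real.exp K2 / lam ^ p * ZZ (randComp T ω k) B ≤ 1 / 2 * C :=
          (mul_le_mul_of_nonneg_left h2 (by positivity)).trans
            (mul_le_mul_of_nonneg_right b1 hCn)
        have b3 : Real.exp K2 / (Cg⁻¹ * lam ^ p) ≤ Real.exp K2 * |Cg| := by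
          rw [abs_of_pos g2]
          have : Real.exp K2 / (Cg⁻¹ * lam ^ p) = Real.exp K2 * Cg / lam ^ p := by field_simp
          rw [this]
          exact div_le_self (by positivity) (one_le_pow₀ hlam.le)
        linarith

lemma short_return {m : ℕ} {T : Fin m → ℝ → ℝ} {lam : ℝ} (hlam : 1 < lam)
    (hT : ∀ i, PiecewiseC2Expanding (T i) lam)
    (hmaps : ∀ i, Set.MapsTo (T i) (Set.Icc 0 1) (Set.Icc 0 1)) :
    ∃ C : ℝ, 0 < C ∧ ∀ (ω : Om m) (k : ℕ) (ε : ℝ), 1 ≤ k → 0 ≤ ε →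
      volume {x | x ∈ Set.Icc (0:ℝ) 1 ∧ |randComp T ω k x - x| ≤ ε} ≤ ENNReal.ofReal (C * ε) := by
  have hl : 0 < lam - 1 := by linarith
  have h1 := fun i => pw_nice hlam (hT i) (hmaps i)
  choose B K hK0 hN using h1
  obtain ⟨K2, C, hK2, hC, hu⟩ := rand_unif (T := T) (K0 := ∑ i, K i) hlam
    (Finset.sum_nonneg fun i _ => hK0 i)
    (fun i => ⟨B i, (hN i).monoK (Finset.single_le_sum (f := K) (fun i _ => hK0 i)
      (Finset.mem_univ i))⟩)
  refine ⟨2 * (lam / (lam - 1)) * Real.exp K2 * C + 1, by positivity, ?_⟩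
  intro ω k ε hk hε
  obtain ⟨B, hB, hZ⟩ := hu k ω
  refine (hB.short hK2 hlam ?_ hε).trans (ENNReal.ofReal_le_ofReal ?_)
  · calc lam = lam ^ 1 := (pow_one _).symm
      _ ≤ lam ^ k := pow_le_pow_right₀ hlam.le hk
  · calc 2 * ε * (lam / (lam - 1)) * Real.exp K2 * ZZ (randComp T ω k) B
        ≤ 2 * ε * (lam / (lam - 1)) * Real.exp K2 * C :=
          mul_le_mul_of_nonneg_left hZ (by positivity)
      _ ≤ _ := by nlinarith

lemma ball_fubini {M : Set ℝ} (hM : MeasurableSet M) {r : ℝ} :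
    Measurable (fun x0 : ℝ => volume (Metric.ball x0 r ∩ M)) ∧
    ∫⁻ x0, volume (Metric.ball x0 r ∩ M) = ENNReal.ofReal (2 * r) * volume M := by
  have hs : MeasurableSet {q : ℝ × ℝ | dist q.2 q.1 < r ∧ q.2 ∈ M} :=
    MeasurableSet.inter (s₁ := {q : ℝ × ℝ | dist q.2 q.1 < r}) (s₂ := Prod.snd ⁻¹' M)
      (measurableSet_lt (measurable_snd.dist measurable_fst) measurable_const) (measurable_snd hM)
  have e1 : ∀ x0 : ℝ, Metric.ball x0 r ∩ M =
      Prod.mk x0 ⁻¹' {q : ℝ × ℝ | dist q.2 q.1 < r ∧ q.2 ∈ M} := by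
    intro x0; ext x; simp
  simp_rw [e1]
  refine ⟨measurable_measure_prodMk_left hs, ?_⟩
  rw [← Measure.prod_apply hs, Measure.prod_apply_symm hs]
  have e2 : ∀ x : ℝ, volume ((fun x0 => (x0, x)) ⁻¹' {q : ℝ × ℝ | dist q.2 q.1 < r ∧ q.2 ∈ M}) =
      M.indicator (fun _ => ENNReal.ofReal (2 * r)) x := by
    intro x
    by_cases hx : x ∈ M
    · rw [Set.indicator_of_mem hx, ← Real.volume_ball x r]
      congr 1
      ext y
      simp [hx, dist_comm]
    · rw [Set.indicator_of_notMem hx]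
      have : ((fun x0 => (x0, x)) ⁻¹' {q : ℝ × ℝ | dist q.2 q.1 < r ∧ q.2 ∈ M}) = ∅ := by
        ext y; simp [hx]
      rw [this, measure_empty]
  simp_rw [e2]
  rw [lintegral_indicator hM, lintegral_const, Measure.restrict_apply_univ]

theorem stmt8 (m : ℕ) (hm : 1 ≤ m) (T : Fin m → ℝ → ℝ) (lam : ℝ) (hlam : 1 < lam)
    (hT : ∀ i, PiecewiseC2Expanding (T i) lam)
    (hmaps : ∀ i, Set.MapsTo (T i) (Set.Icc 0 1) (Set.Icc 0 1))
    (a ψ κ : ℝ) (ha : 0 < a) (hψ1 : 2 / 3 < ψ) (hψ2 : ψ < 1)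
    (hκ1 : 0 < κ) (hκ2 : κ < 3 * ψ - 2) :
    ∃ γ1 γ2 : ℕ → ℝ,
      (∃ C : ℝ, 0 < C ∧ ∀ n : ℕ, 1 ≤ n → |γ1 n| ≤ C * (n : ℝ) ^ (-κ)) ∧
      Tendsto γ2 atTop (𝓝 0) ∧
      ∀ ω : Om m, ∃ A : ℕ → Set ℝ,
        (∀ n, MeasurableSet (A n) ∧ A n ⊆ Set.Icc 0 1 ∧
          volume (A n) ≤ ENNReal.ofReal (γ1 n)) ∧
        ∀ n : ℕ, 1 ≤ n → ∀ x0 ∈ Set.Icc (0 : ℝ) 1, x0 ∉ A n →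
          Real.log n * ∑ i ∈ Finset.range n,
            (mLeb (Metric.ball x0 ((n : ℝ) ^ (-ψ)) ∩
              hitWithin T (shift^[i] ω) (Metric.ball x0 ((n : ℝ) ^ (-ψ)))
                ⌊a * Real.log n⌋₊)).toReal
          ≤ γ2 n := by
  obtain ⟨C1, hC1, hsr⟩ := short_return hlam hT hmaps
  set s := (1 - ψ) / 3 with hs
  have hs0 : 0 < s := by rw [hs]; linarith
  set C := 4 * C1 * a * (1 / s) * (1 + 1 / s) with hC
  have hC0 : 0 < C := by positivity
  refine ⟨fun n => C * (n : ℝ) ^ (-κ), fun n => (n : ℝ) ^ (-s), ⟨C, hC0, ?_⟩, ?_, ?_⟩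
  · intro n hn
    rw [abs_of_nonneg (by positivity)]
  · exact (tendsto_rpow_neg_atTop hs0).comp tendsto_natCast_atTop_atTop
  intro ω
  have main : ∀ n : ℕ, ∃ A : Set ℝ, (MeasurableSet A ∧ A ⊆ Set.Icc 0 1 ∧
      volume A ≤ ENNReal.ofReal (C * (n : ℝ) ^ (-κ))) ∧
      (1 ≤ n → ∀ x0 ∈ Set.Icc (0 : ℝ) 1, x0 ∉ A →
          Real.log n * ∑ i ∈ Finset.range n,
            (mLeb (Metric.ball x0 ((n : ℝ) ^ (-ψ)) ∩
              hitWithin T (shift^[i] ω) (Metric.ball x0 ((n : ℝ) ^ (-ψ)))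
                ⌊a * Real.log n⌋₊)).toReal
          ≤ (n : ℝ) ^ (-s)) := by
    intro n
    rcases Nat.eq_zero_or_pos n with rfl | hn
    · exact ⟨∅, ⟨MeasurableSet.empty, Set.empty_subset _, by simp⟩, fun h => by omega⟩
    have hn1 : (1:ℝ) ≤ n := by exact_mod_cast hn
    have hnp : (0:ℝ) < n := by linarith
    have hlog : 0 ≤ Real.log n := Real.log_nonneg hn1
    set r := (n : ℝ) ^ (-ψ) with hr
    have hr0 : 0 < r := by positivity
    set N := ⌊a * Real.log n⌋₊ with hN
    have hNle : (N : ℝ) ≤ a * Real.log n := Nat.floor_le (by positivity)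
    set E : ℕ → ℕ → Set ℝ := fun i k =>
      {x | x ∈ Set.Icc (0:ℝ) 1 ∧ |randComp T (shift^[i] ω) k x - x| ≤ 2 * r} with hE
    set M : ℕ → ℕ → Set ℝ := fun i k => toMeasurable volume (E i k) with hM
    have hMm : ∀ i k, MeasurableSet (M i k) := fun i k => measurableSet_toMeasurable _ _
    have hMv : ∀ i k, 1 ≤ k → volume (M i k) ≤ ENNReal.ofReal (C1 * (2 * r)) := by
      intro i k hk
      rw [hM]
      simp only
      rw [measure_toMeasurable]
      exact hsr _ k (2 * r) hk (by positivity)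
    set h : ℝ → ENNReal := fun x0 => ∑ i ∈ Finset.range n, ∑ k ∈ Finset.Icc 1 N,
      volume (Metric.ball x0 r ∩ M i k) with hh
    have hhm : Measurable h := Finset.measurable_fun_sum _ fun i _ =>
      Finset.measurable_fun_sum _ fun k _ => (ball_fubini (hMm i k)).1
    have hint : ∫⁻ x0, h x0 ≤ ENNReal.ofReal (n * (N * (2 * r * (C1 * (2 * r))))) := by
      rw [hh]
      rw [lintegral_finsetSum _ (fun i _ => Finset.measurable_fun_sum _ fun k _ =>
        (ball_fubini (hMm i k)).1)]
      calc _ ≤ ∑ i ∈ Finset.range n, ∑ k ∈ Finset.Icc 1 N,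
            ENNReal.ofReal (2 * r * (C1 * (2 * r))) := by
            refine Finset.sum_le_sum fun i _ => ?_
            rw [lintegral_finsetSum _ (fun k _ => (ball_fubini (hMm i k)).1)]
            refine Finset.sum_le_sum fun k hk => ?_
            rw [(ball_fubini (hMm i k)).2, ENNReal.ofReal_mul (p := 2 * r) (by positivity)]
            exact mul_le_mul_right (hMv i k (Finset.mem_Icc.1 hk).1) _
        _ = _ := by
            simp only [Finset.sum_const, Finset.card_range, Nat.card_Icc, nsmul_eq_mul,
              Nat.add_sub_cancel]
            rw [ENNReal.ofReal_mul (Nat.cast_nonneg n), ENNReal.ofReal_mul (Nat.cast_nonneg N),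
              ENNReal.ofReal_natCast, ENNReal.ofReal_natCast]
    set θ := (n : ℝ) ^ (-s) / (1 + Real.log n) with hθ
    have hθ0 : 0 < θ := by positivity
    refine ⟨Set.Icc 0 1 ∩ {x0 | ENNReal.ofReal θ ≤ h x0}, ⟨?_, Set.inter_subset_left, ?_⟩, ?_⟩
    · exact measurableSet_Icc.inter (measurableSet_le measurable_const hhm)
    · have mk := meas_ge_le_lintegral_div (μ := volume) hhm.aemeasurable
        (ε := ENNReal.ofReal θ) (by simpa using hθ0) ENNReal.ofReal_ne_top
      refine (measure_mono Set.inter_subset_right).trans (mk.trans ?_)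
      refine (ENNReal.div_le_div_right hint _).trans ?_
      rw [← ENNReal.ofReal_div_of_pos hθ0]
      refine ENNReal.ofReal_le_ofReal ?_
      have l1 : Real.log n ≤ (n:ℝ) ^ s / s := Real.log_le_rpow_div hnp.le hs0
      have hone : (1:ℝ) ≤ (n:ℝ) ^ s := Real.one_le_rpow hn1 hs0.le
      have l2 : 1 + Real.log n ≤ (n:ℝ) ^ s * (1 + 1 / s) := by
        have : (n:ℝ) ^ s * (1 + 1 / s) = (n:ℝ) ^ s + (n:ℝ) ^ s / s := by ring
        linarith
      have l3 : (N : ℝ) ≤ a * ((n:ℝ) ^ s / s) :=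
        hNle.trans (mul_le_mul_of_nonneg_left l1 ha.le)
      have e1 : (n * (N * (2 * r * (C1 * (2 * r))))) / θ =
          4 * C1 * (n * (r * r)) * ((n:ℝ) ^ s) * (N * (1 + Real.log n)) := by
        rw [hθ, Real.rpow_neg hnp.le]
        field_simp
        ring
      rw [e1]
      have l4 : (N : ℝ) * (1 + Real.log n) ≤
          (a * ((n:ℝ) ^ s / s)) * ((n:ℝ) ^ s * (1 + 1 / s)) :=
        mul_le_mul l3 l2 (by positivity) (by positivity)
      calc 4 * C1 * (n * (r * r)) * ((n:ℝ) ^ s) * (N * (1 + Real.log n))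
          ≤ 4 * C1 * (n * (r * r)) * ((n:ℝ) ^ s) *
            ((a * ((n:ℝ) ^ s / s)) * ((n:ℝ) ^ s * (1 + 1 / s))) :=
            mul_le_mul_of_nonneg_left l4 (by positivity)
        _ = C * ((n:ℝ) ^ (1:ℝ) * (r * r) * ((n:ℝ) ^ s * (n:ℝ) ^ s * (n:ℝ) ^ s)) := by
            rw [hC, Real.rpow_one]; ring
        _ = C * (n:ℝ) ^ (1 + (-ψ + -ψ) + (s + s + s)) := by
            rw [hr, Real.rpow_add hnp (1 + (-ψ + -ψ)), Real.rpow_add hnp (s + s),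
              Real.rpow_add hnp s s, Real.rpow_add hnp 1, Real.rpow_add hnp (-ψ)]
        _ ≤ C * (n:ℝ) ^ (-κ) := by
            refine mul_le_mul_of_nonneg_left (Real.rpow_le_rpow_of_exponent_le hn1 ?_) hC0.le
            rw [hs]; linarith
    · intro _ x0 hx0 hxA
      have hlt : h x0 < ENNReal.ofReal θ := by
        by_contra hcon
        exact hxA ⟨hx0, not_lt.1 hcon⟩
      have hterm : ∀ i ∈ Finset.range n, mLeb (Metric.ball x0 r ∩
          hitWithin T (shift^[i] ω) (Metric.ball x0 r) N) ≤
          ∑ k ∈ Finset.Icc 1 N, volume (Metric.ball x0 r ∩ M i k) := by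
        intro i _
        rw [mLeb, Measure.restrict_apply' measurableSet_Icc]
        refine le_trans (measure_mono ?_) (measure_biUnion_finset_le _ _)
        rintro x ⟨⟨hxb, k, hk1, hk2, hkb⟩, hxI⟩
        simp only [Set.mem_iUnion]
        refine ⟨k, Finset.mem_Icc.2 ⟨hk1, hk2⟩, hxb, subset_toMeasurable _ _ ⟨hxI, ?_⟩⟩
        have d1 := Metric.mem_ball.1 hxb
        have d2 := Metric.mem_ball.1 hkb
        rw [← Real.dist_eq]
        have := dist_triangle_right (randComp T (shift^[i] ω) k x) x x0
        linarith
      have hsum : ∑ i ∈ Finset.range n, mLeb (Metric.ball x0 r ∩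
          hitWithin T (shift^[i] ω) (Metric.ball x0 r) N) ≤ ENNReal.ofReal θ :=
        (Finset.sum_le_sum hterm).trans hlt.le
      have hne : ∀ i ∈ Finset.range n, mLeb (Metric.ball x0 r ∩
          hitWithin T (shift^[i] ω) (Metric.ball x0 r) N) ≠ ⊤ := by
        intro i hi
        exact ne_top_of_le_ne_top ENNReal.ofReal_ne_top
          ((Finset.single_le_sum (f := fun i => mLeb (Metric.ball x0 r ∩
            hitWithin T (shift^[i] ω) (Metric.ball x0 r) N)) (fun _ _ => bot_le) hi).trans hsum)
      rw [← ENNReal.toReal_sum hne]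
      have ht := ENNReal.toReal_le_of_le_ofReal hθ0.le hsum
      calc _ ≤ Real.log n * θ := mul_le_mul_of_nonneg_left ht hlog
        _ = (n:ℝ) ^ (-s) * (Real.log n / (1 + Real.log n)) := by rw [hθ]; ring
        _ ≤ (n:ℝ) ^ (-s) * 1 := by
          refine mul_le_mul_of_nonneg_left ?_ (by positivity)
          rw [div_le_one (by positivity)]; linarith
        _ = _ := mul_one _
  choose A hA using main
  exact ⟨A, fun n => (hA n).1, fun n hn => (hA n).2 hn⟩
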